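/- Let A be a unital, infinite-dimensional C*-algebra of real rank zero and τ a tracial state on A. Then inf{τ(p) : p a nonzero projection in A} = 0. -/

import Mathlib

open scoped ComplexOrder

namespace RRZ

section
variable {A : Type*} [CStarAlgebra A]

/-- Projections. -/
def Proj (p : A) : Prop := IsIdempotentElem p ∧ IsSelfAdjoint p

/-- Indicator functions of points. -/
noncomputable def ind (m : ℂ) : ℂ → ℂ := fun z => if z = m then 1 else 0

lemma cont_fin (v : A) (hf : (spectrum ℂ v).Finite) (f : ℂ → ℂ) :
    ContinuousOn f (spectrum ℂ v) := hf.continuousOn f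

lemma proj_ind (v : A) (hv : IsSelfAdjoint v) (hf : (spectrum ℂ v).Finite) (m : ℂ) :
    Proj (cfc (ind m) v) := by
  have hn : IsStarNormal v := hv.isStarNormal
  constructor
  · unfold IsIdempotentElem
    rw [← cfc_mul (ind m) (ind m) v (cont_fin v hf _) (cont_fin v hf _)]
    congr 1
    funext z
    simp [ind]
  · unfold IsSelfAdjoint
    rw [← cfc_star]
    congr 1
    funext z
    simp only [ind]
    split_ifs <;> simp

lemma ind_ne_zero (v : A) (hv : IsSelfAdjoint v) (hf : (spectrum ℂ v).Finite) (m : ℂ)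
    (hm : m ∈ spectrum ℂ v) : cfc (ind m) v ≠ 0 := by
  have hn : IsStarNormal v := hv.isStarNormal
  intro h
  rw [← cfc_zero ℂ v] at h
  have := (cfc_eq_cfc_iff_eqOn (R := ℂ) (a := v) (f := ind m) (g := 0) hn (cont_fin v hf _) (cont_fin v hf _)).1 h hm
  simp [ind] at this

lemma sum_ind (v : A) (hv : IsSelfAdjoint v) (hf : (spectrum ℂ v).Finite) (g : ℂ → ℂ) :
    ∑ m ∈ hf.toFinset, g m • cfc (ind m) v = cfc g v := by
  have hn : IsStarNormal v := hv.isStarNormal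
  have h1 : ∀ m ∈ hf.toFinset, g m • cfc (ind m) v = cfc (fun z => g m • ind m z) v := by
    intro m _
    rw [cfc_smul (g m) (ind m) v (cont_fin v hf _)]
  rw [Finset.sum_congr rfl h1, ← cfc_sum (fun m z => g m • ind m z) v hf.toFinset
    (fun m _ => cont_fin v hf _)]
  apply cfc_congr
  intro z hz
  have : z ∈ hf.toFinset := by simpa using hz
  simp [ind, this, -Set.Finite.mem_toFinset]

lemma near (a v : A) (hv : IsSelfAdjoint v) (ε : ℝ) (hε : 0 < ε) (h : ‖a - v‖ < ε) (l : ℂ)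
    (hl : l ∈ spectrum ℂ a) : ∃ m ∈ spectrum ℂ v, ‖l - m‖ < ε := by
  have hn : IsStarNormal v := hv.isStarNormal
  by_contra! hc
  have hne : ∀ z ∈ spectrum ℂ v, l - z ≠ 0 := by
    intro z hz h0
    have := hc z hz
    rw [h0, norm_zero] at this
    linarith
  have hcont : ContinuousOn (fun z : ℂ => (l - z)⁻¹) (spectrum ℂ v) :=
    ContinuousOn.inv₀ (by fun_prop) hne
  have hcont2 : ContinuousOn (fun z : ℂ => l - z) (spectrum ℂ v) := by fun_prop
  have e1 : cfc (fun z : ℂ => l - z) v = algebraMap ℂ A l - v := by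
    rw [cfc_sub (fun _ => l) (fun z => z) v, cfc_const l v, cfc_id' ℂ v]
  have m1 : (algebraMap ℂ A l - v) * cfc (fun z : ℂ => (l - z)⁻¹) v = 1 := by
    rw [← e1, ← cfc_mul _ _ v hcont2 hcont, ← cfc_one ℂ v]
    apply cfc_congr
    intro z hz
    simp [hne z hz]
  have m2 : cfc (fun z : ℂ => (l - z)⁻¹) v * (algebraMap ℂ A l - v) = 1 := by
    rw [← e1, ← cfc_mul _ _ v hcont hcont2, ← cfc_one ℂ v]
    apply cfc_congr
    intro z hz
    simp [hne z hz]
  have hnorm : ‖cfc (fun z : ℂ => (l - z)⁻¹) v‖ ≤ ε⁻¹ := by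
    apply norm_cfc_le (by positivity)
    intro z hz
    rw [norm_inv]
    exact inv_anti₀ hε (hc z hz)
  set r := cfc (fun z : ℂ => (l - z)⁻¹) v with hr
  have hlt : ‖r * (a - v)‖ < 1 := by
    calc ‖r * (a - v)‖ ≤ ‖r‖ * ‖a - v‖ := norm_mul_le _ _
      _ ≤ ε⁻¹ * ‖a - v‖ := by gcongr
      _ < ε⁻¹ * ε := by gcongr
      _ = 1 := inv_mul_cancel₀ hε.ne'
  have hu : IsUnit (1 - r * (a - v)) := isUnit_one_sub_of_norm_lt_one hlt
  have hu2 : IsUnit (algebraMap ℂ A l - v) := ⟨⟨_, r, m1, m2⟩, rfl⟩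
  have : algebraMap ℂ A l - a = (algebraMap ℂ A l - v) * (1 - r * (a - v)) := by
    rw [mul_sub, ← mul_assoc, m1]
    noncomm_ring
  exact hl (show IsUnit (algebraMap ℂ A l - a) from this ▸ hu2.mul hu)

lemma card_le
    (τ : A →ₗ[ℂ] ℂ) (hτ1 : τ 1 = 1) (c : ℝ)
    (hτc : ∀ p : A, Proj p → p ≠ 0 → c ≤ (τ p).re) (v : A) (hv : IsSelfAdjoint v) (hf : (spectrum ℂ v).Finite) :
    hf.toFinset.card * c ≤ 1 := by
  have hn : IsStarNormal v := hv.isStarNormal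
  have h := sum_ind v hv hf (fun _ => 1)
  rw [cfc_const_one ℂ v] at h
  have h2 := congrArg (fun x => (τ x).re) h
  simp only [one_smul, map_sum, hτ1, Complex.re_sum, Complex.one_re] at h2
  rw [← h2, ← nsmul_eq_mul]
  apply Finset.card_nsmul_le_sum
  intro m hm
  exact hτc _ (proj_ind v hv hf m) (ind_ne_zero v hv hf m (by simpa using hm))

lemma spec_finite
    (hRR0 : ∀ a : A, IsSelfAdjoint a → ∀ ε : ℝ, 0 < ε →
      ∃ v : A, IsSelfAdjoint v ∧ (spectrum ℂ v).Finite ∧ ‖a - v‖ < ε)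
    (τ : A →ₗ[ℂ] ℂ) (hτ1 : τ 1 = 1) (c : ℝ) (hc : 0 < c)
    (hτc : ∀ p : A, Proj p → p ≠ 0 → c ≤ (τ p).re) (a : A) (ha : IsSelfAdjoint a) : (spectrum ℂ a).Finite := by
  by_contra hinf
  obtain ⟨N, hN⟩ := exists_nat_gt (1 / c)
  obtain ⟨t, hts, htc⟩ := Set.Infinite.exists_subset_card_eq hinf N
  have hfin : (t : Set ℂ).Finite := t.finite_toSet
  obtain ⟨δ, hδ, hsep⟩ : ∃ δ : ℝ, 0 < δ ∧ ∀ x ∈ t, ∀ y ∈ t, x ≠ y → δ ≤ dist x y := by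
    by_cases hne : t.offDiag.Nonempty
    · obtain ⟨q, hq, hmin⟩ := Finset.exists_min_image t.offDiag (fun q => dist q.1 q.2) hne
      refine ⟨dist q.1 q.2, dist_pos.2 (Finset.mem_offDiag.1 hq).2.2, ?_⟩
      intro x hx y hy hxy
      exact hmin (x, y) (Finset.mem_offDiag.2 ⟨hx, hy, hxy⟩)
    · refine ⟨1, one_pos, fun x hx y hy hxy => ?_⟩
      exact absurd ⟨(x, y), Finset.mem_offDiag.2 ⟨hx, hy, hxy⟩⟩ hne
  obtain ⟨v, hv, hf, hav⟩ := hRR0 a ha (δ / 2) (by positivity)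
  have hch : ∀ l ∈ t, ∃ m ∈ spectrum ℂ v, ‖l - m‖ < δ / 2 := fun l hl =>
    near a v hv _ (by positivity) hav l (hts hl)
  choose! g hg1 hg2 using hch
  have hle : t.card ≤ hf.toFinset.card := by
    apply Finset.card_le_card_of_injOn g
    · intro l hl
      simpa using hg1 l hl
    · intro x hx y hy hxy
      by_contra hne
      have h1 := hsep x hx y hy hne
      have h2 := hg2 x hx
      have h3 := hg2 y hy
      rw [← hxy] at h3
      rw [← dist_eq_norm] at h2 h3
      have := dist_triangle_right x y (g x)
      linarith
  have hcard := card_le τ hτ1 c hτc v hv hf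
  rw [htc] at hle
  have : (N : ℝ) ≤ hf.toFinset.card := by exact_mod_cast hle
  rw [div_lt_iff₀ hc] at hN
  nlinarith

/-- Minimal projections. -/
def Mini (p : A) : Prop := Proj p ∧ ∀ q : A, Proj q → p * q = q → q = 0 ∨ q = p

lemma mini_sa (hfin : ∀ a : A, IsSelfAdjoint a → (spectrum ℂ a).Finite) (p : A) (hp : Mini p)
    (a : A) (ha : IsSelfAdjoint a) (hpa : p * a = a) : ∃ k : ℂ, a = k • p := by
  have hn : IsStarNormal a := ha.isStarNormal
  have hf := hfin a ha
  have h := sum_ind a ha hf id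
  rw [cfc_id ℂ a] at h
  have key : a ∈ Submodule.span ℂ {p} := by
    rw [← h]
    apply Submodule.sum_mem
    intro m _
    by_cases hm : m = 0
    · simp [hm]
    · apply Submodule.smul_mem
      have e : a * cfc (ind m) a = m • cfc (ind m) a := by
        have e0 : a * cfc (ind m) a = cfc (fun z : ℂ => z) a * cfc (ind m) a := by
          rw [cfc_id' ℂ a]
        rw [e0, ← cfc_mul _ _ a (cont_fin a hf _) (cont_fin a hf _),
          ← cfc_smul m (ind m) a (cont_fin a hf _)]
        congr 1
        funext z
        by_cases hz : z = m <;> simp [ind, hz]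
      have e2 : p * cfc (ind m) a = cfc (ind m) a := by
        have e3 : cfc (ind m) a = m⁻¹ • (a * cfc (ind m) a) := by
          rw [e, smul_smul, inv_mul_cancel₀ hm, one_smul]
        rw [e3, mul_smul_comm, ← mul_assoc, hpa]
      rcases hp.2 _ (proj_ind a ha hf m) e2 with h0 | h0
      · rw [h0]; exact Submodule.zero_mem _
      · rw [h0]; exact Submodule.mem_span_singleton_self p
  obtain ⟨k, hk⟩ := Submodule.mem_span_singleton.1 key
  exact ⟨k, hk.symm⟩

lemma mini_all (hfin : ∀ a : A, IsSelfAdjoint a → (spectrum ℂ a).Finite) (p : A) (hp : Mini p)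
    (b : A) (hpb : p * b = b) (hbp : b * p = b) : ∃ k : ℂ, b = k • p := by
  have hps : star p = p := hp.1.2
  have hs : p * star b = star b := by
    rw [← hps, ← star_mul, hbp]
  have hi : p * (Complex.I • (star b - b)) = Complex.I • (star b - b) := by
    rw [mul_smul_comm, mul_sub, hs, hpb]
  have hi2 : IsSelfAdjoint (Complex.I • (star b - b)) := by
    unfold IsSelfAdjoint
    rw [star_smul, star_sub, star_star]
    simp only [RCLike.star_def, Complex.conj_I]
    rw [neg_smul, ← smul_neg, neg_sub]
  obtain ⟨k, hk⟩ := mini_sa hfin p hp (b + star b) (IsSelfAdjoint.add_star_self b)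
    (by rw [mul_add, hpb, hs])
  obtain ⟨l, hl⟩ := mini_sa hfin p hp _ hi2 hi
  refine ⟨(2 : ℂ)⁻¹ * (k + Complex.I * l), ?_⟩
  rw [mul_smul, add_smul, mul_smul, ← hk, ← hl, smul_smul, Complex.I_mul_I]
  have : b + star b + (-1 : ℂ) • (star b - b) = (2 : ℂ) • b := by
    rw [neg_one_smul, two_smul]; abel
  rw [this, smul_smul, inv_mul_cancel₀ two_ne_zero, one_smul]

/-- Two-sided multiplication. -/
noncomputable def mm (p q : A) : A →ₗ[ℂ] A := (LinearMap.mulLeft ℂ p).comp (LinearMap.mulRight ℂ q)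

lemma mm_apply (p q x : A) : mm p q x = p * (x * q) := rfl

lemma mini_fd (hfin : ∀ a : A, IsSelfAdjoint a → (spectrum ℂ a).Finite) (p q : A) (hp : Mini p)
    (hq : Mini q) : FiniteDimensional ℂ (LinearMap.range (mm p q)) := by
  have hpp : p * p = p := hp.1.1
  have hqq : q * q = q := hq.1.1
  have hps : star p = p := hp.1.2
  have hqs : star q = q := hq.1.2
  by_cases h : ∃ x : A, mm p q x ≠ 0
  · obtain ⟨x0, hx0⟩ := h
    obtain ⟨x, hx⟩ : ∃ x, x = mm p q x0 := ⟨_, rfl⟩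
    rw [← hx] at hx0
    have hl : ∀ y z, z = mm p q y → p * z = z := by
      rintro y z rfl; rw [mm_apply, ← mul_assoc, hpp]
    have hr : ∀ y z, z = mm p q y → z * q = z := by
      rintro y z rfl; rw [mm_apply, mul_assoc, mul_assoc, hqq]
    have hpx := hl _ _ hx
    have hxq := hr _ _ hx
    have hqx : q * star x = star x := by rw [← hqs, ← star_mul, hxq]
    have hxp : star x * p = star x := by rw [← hps, ← star_mul, hpx]
    obtain ⟨l, hl1⟩ := mini_all hfin q hq (star x * x) (by rw [← mul_assoc, hqx])
      (by rw [mul_assoc, hxq])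
    have hl0 : l ≠ 0 := by
      rintro rfl
      rw [zero_smul] at hl1
      exact hx0 ((CStarRing.star_mul_self_eq_zero_iff x).1 hl1)
    have hle : LinearMap.range (mm p q) ≤ Submodule.span ℂ {x} := by
      rintro z ⟨y, hy⟩
      have hpz := hl _ _ hy.symm
      have hzq := hr _ _ hy.symm
      obtain ⟨k, hk⟩ := mini_all hfin p hp (z * star x) (by rw [← mul_assoc, hpz])
        (by rw [mul_assoc, hxp])
      have e : l • z = k • x := by
        calc l • z = z * (l • q) := by rw [mul_smul_comm, hzq]
          _ = z * star x * x := by rw [← hl1, mul_assoc]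
          _ = k • x := by rw [hk, smul_mul_assoc, hpx]
      rw [Submodule.mem_span_singleton]
      refine ⟨l⁻¹ * k, ?_⟩
      rw [mul_smul, ← e, smul_smul, inv_mul_cancel₀ hl0, one_smul]
    exact Submodule.finiteDimensional_of_le hle
  · push Not at h
    have : mm p q = 0 := LinearMap.ext h
    rw [this, LinearMap.range_zero]
    infer_instance

lemma fd_add (f g : A →ₗ[ℂ] A) (hf : FiniteDimensional ℂ (LinearMap.range f))
    (hg : FiniteDimensional ℂ (LinearMap.range g)) :
    FiniteDimensional ℂ (LinearMap.range (f + g)) := by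
  have : LinearMap.range (f + g) ≤ LinearMap.range f ⊔ LinearMap.range g :=
    LinearMap.range_add_le f g
  exact Submodule.finiteDimensional_of_le this

lemma clos_fd (hfin : ∀ a : A, IsSelfAdjoint a → (spectrum ℂ a).Finite) (p q : A)
    (hp : p ∈ AddSubmonoid.closure {p : A | Mini p})
    (hq : q ∈ AddSubmonoid.closure {p : A | Mini p}) :
    FiniteDimensional ℂ (LinearMap.range (mm p q)) := by
  have z1 : ∀ q : A, mm 0 q = 0 := fun q => by ext; simp [mm_apply]
  have z2 : ∀ q : A, mm q 0 = 0 := fun q => by ext; simp [mm_apply]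
  have a1 : ∀ x y q : A, mm (x + y) q = mm x q + mm y q := fun x y q => by
    ext; simp [mm_apply, add_mul]
  have a2 : ∀ x y q : A, mm q (x + y) = mm q x + mm q y := fun x y q => by
    ext; simp [mm_apply, mul_add]
  induction hp using AddSubmonoid.closure_induction with
  | mem x hx =>
    induction hq using AddSubmonoid.closure_induction with
    | mem y hy => exact mini_fd hfin x y hx hy
    | zero => rw [z2, LinearMap.range_zero]; infer_instance
    | add y z _ _ h1 h2 => rw [a2]; exact fd_add _ _ h1 h2
  | zero => rw [z1, LinearMap.range_zero]; infer_instance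
  | add y z _ _ h1 h2 => rw [a1]; exact fd_add _ _ h1 h2

lemma decomp
    (τ : A →ₗ[ℂ] ℂ) (c : ℝ) (hc : 0 < c)
    (hτc : ∀ p : A, Proj p → p ≠ 0 → c ≤ (τ p).re) (n : ℕ) : ∀ p : A, Proj p → (τ p).re < n * c →
    p ∈ AddSubmonoid.closure {p : A | Mini p} := by
  induction n with
  | zero =>
    intro p hp h
    by_cases h0 : p = 0
    · rw [h0]; exact zero_mem _
    · have := hτc p hp h0
      have hc0 : (τ p).re < 0 := by simpa using h
      linarith
  | succ n ih =>
    intro p hp h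
    by_cases hm : Mini p
    · exact AddSubmonoid.subset_closure hm
    · have : ∃ q : A, Proj q ∧ p * q = q ∧ q ≠ 0 ∧ q ≠ p := by
        by_contra! hcon
        exact hm ⟨hp, fun q hq hpq => or_iff_not_imp_left.2 (hcon q hq hpq)⟩
      obtain ⟨q, hq, hpq, hq0, hqp⟩ := this
      have hqp2 : q * p = q := by
        have := congrArg star hpq
        rwa [star_mul, hq.2.star_eq, hp.2.star_eq] at this
      have hd : Proj (p - q) := by
        refine ⟨?_, hp.2.sub hq.2⟩
        unfold IsIdempotentElem
        rw [sub_mul, mul_sub, mul_sub, hpq, hqp2, hp.1.eq, hq.1.eq]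
        abel
      have t1 := hτc q hq hq0
      have t2 := hτc _ hd (sub_ne_zero.2 hqp.symm)
      have t3 : (τ p).re = (τ q).re + (τ (p - q)).re := by rw [map_sub]; simp
      push_cast at h
      have m1 := ih q hq (by linarith)
      have m2 := ih _ hd (by linarith)
      have := add_mem m1 m2
      rwa [add_sub_cancel] at this

lemma main
    (hRR0 : ∀ a : A, IsSelfAdjoint a → ∀ ε : ℝ, 0 < ε →
      ∃ v : A, IsSelfAdjoint v ∧ (spectrum ℂ v).Finite ∧ ‖a - v‖ < ε)
    (τ : A →ₗ[ℂ] ℂ) (hτ1 : τ 1 = 1) (c : ℝ) (hc : 0 < c)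
    (hτc : ∀ p : A, Proj p → p ≠ 0 → c ≤ (τ p).re) : FiniteDimensional ℂ A := by
  have hfin := spec_finite hRR0 τ hτ1 c hc hτc
  obtain ⟨n, hn⟩ := exists_nat_gt (1 / c)
  rw [div_lt_iff₀ hc] at hn
  have h1 : (1 : A) ∈ AddSubmonoid.closure {p : A | Mini p} :=
    decomp τ c hc hτc n 1 ⟨IsIdempotentElem.one, IsSelfAdjoint.one A⟩ (by simpa [hτ1] using hn)
  have := clos_fd hfin 1 1 h1 h1
  have e : mm (1 : A) 1 = LinearMap.id := by ext; simp [mm_apply]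
  rw [e, LinearMap.range_id] at this
  exact Module.finite_def.2 ((Submodule.fg_iff_finiteDimensional _).2 this)

end
end RRZ

/-- If `A` is a unital infinite-dimensional C*-algebra of real rank zero and
`τ` is a tracial state on `A`, then `inf {τ p : p a nonzero projection in A} = 0`. -/
theorem inf_trace_of_projections_eq_zero
    {A : Type*} [NormedRing A] [StarRing A] [CStarRing A] [NormedAlgebra ℂ A]
    [StarModule ℂ A] [CompleteSpace A]
    (hinfdim : ¬ FiniteDimensional ℂ A)
    -- real rank zero
    (hRR0 : ∀ a : A, IsSelfAdjoint a → ∀ ε : ℝ, 0 < ε →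
      ∃ v : A, IsSelfAdjoint v ∧ (spectrum ℂ v).Finite ∧ ‖a - v‖ < ε)
    -- a tracial state
    (τ : A →ₗ[ℂ] ℂ)
    (hτ1 : τ 1 = 1)
    (hτpos : ∀ a : A, 0 ≤ τ (star a * a))
    (hτtr : ∀ a b : A, τ (a * b) = τ (b * a)) :
    sInf {r : ℝ | ∃ p : A, p ≠ 0 ∧ IsIdempotentElem p ∧ IsSelfAdjoint p ∧ r = (τ p).re}
      = 0 := by
  letI : CStarAlgebra A := { }
  have hpos : ∀ p : A, RRZ.Proj p → 0 ≤ (τ p).re := by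
    intro p hp
    have h := hτpos p
    rw [hp.2.star_eq, hp.1.eq] at h
    exact (Complex.le_def.1 h).1
  have hnn : ∀ r ∈ {r : ℝ | ∃ p : A, p ≠ 0 ∧ IsIdempotentElem p ∧ IsSelfAdjoint p ∧
      r = (τ p).re}, 0 ≤ r := by
    rintro r ⟨p, _, h1, h2, rfl⟩
    exact hpos p ⟨h1, h2⟩
  by_contra hne
  have hc := lt_of_le_of_ne (Real.sInf_nonneg hnn) (Ne.symm hne)
  refine hinfdim (RRZ.main hRR0 τ hτ1 _ hc ?_)
  intro p hp hp0
  exact csInf_le ⟨0, hnn⟩ ⟨p, hp0, hp.1, hp.2, rfl⟩
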